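/- For integers 2 ≤ m ≤ n, the surrounding cop number of the Cartesian product grid P_m □ P_n equals 2 if m, n ≤ 3 and equals 3 otherwise. -/

import Mathlib

/-! Surrounding Cops and Robbers.

Game state: positions of the `k` cops (`Fin k → V`) and of the robber (`V`),
with the cops to move.  On the cops' turn each cop may stay or move along an
edge; the cops win immediately if every neighbour of the robber's vertex is
occupied by a cop.  Otherwise the robber must stay or move along an edge,
ending on a vertex not occupied by any cop (in particular, if a cop lands on
the robber's vertex he is compelled to move off it).  `CopsWin` is the least
fixed point expressing that the cops can force a win in finitely many moves. -/

namespace SurroundGame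

variable {V : Type*} (G : SimpleGraph V)

/-- One legal simultaneous move of the cops: each cop stays or moves along an edge. -/
def CopsMove {k : ℕ} (c c' : Fin k → V) : Prop :=
  ∀ i, c' i = c i ∨ G.Adj (c i) (c' i)

/-- One legal move of the robber (ignoring cop positions): stay or move along an edge. -/
def RobberMove (r r' : V) : Prop :=
  r' = r ∨ G.Adj r r'

/-- The robber at `r` is surrounded: every neighbour of `r` is occupied by a cop. -/
def Surrounded {k : ℕ} (c : Fin k → V) (r : V) : Prop :=
  ∀ w, G.Adj r w → ∃ i, c i = w

/-- With cops at `c`, robber at `r` and the cops to move, the cops can force a win: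
they make a legal move after which either the robber is surrounded, or every legal
robber response (to a vertex free of cops) leads to a position where they again win. -/
inductive CopsWin : {k : ℕ} → (Fin k → V) → V → Prop
  | surround {k : ℕ} (c : Fin k → V) (r : V) (c' : Fin k → V)
      (hmove : CopsMove G c c')
      (hsur : Surrounded G c' r) :
      CopsWin c r
  | step {k : ℕ} (c : Fin k → V) (r : V) (c' : Fin k → V)
      (hmove : CopsMove G c c')
      (hnext : ∀ r', RobberMove G r r' → (∀ i, c' i ≠ r') → CopsWin c' r') :
      CopsWin c r

/-- `k` cops have a winning strategy on `G`: they have an initial placement such that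
whatever starting vertex (unoccupied by cops) the robber picks, the cops win. -/
def CopsWinWith (k : ℕ) : Prop :=
  ∃ c : Fin k → V, ∀ r : V, (∀ i, c i ≠ r) → CopsWin G c r

/-- The surrounding cop number: the least number of cops with a winning strategy. -/
noncomputable def surroundNumber : ℕ :=
  sInf {k | CopsWinWith G k}

end SurroundGame


open SurroundGame

namespace SurroundGame

open SimpleGraph

section General

variable {V : Type*} {G : SimpleGraph V}

/-- Relabelling the cops does not affect the outcome of the game. -/
theorem CopsWin.comp_perm {k : ℕ} {c : Fin k → V} {r : V} (h : CopsWin G c r)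
    (e : Equiv.Perm (Fin k)) : CopsWin G (c ∘ e) r := by
  induction h with
  | surround c r c' hmove hsur =>
    refine .surround _ _ (c' ∘ e) (fun i => hmove (e i)) fun w hw => ?_
    obtain ⟨i, hi⟩ := hsur w hw
    exact ⟨e.symm i, by simpa using hi⟩
  | step c r c' hmove _ ih =>
    refine .step _ _ (c' ∘ e) (fun i => hmove (e i)) fun r' hr hfree => ih r' hr fun i => ?_
    simpa using hfree (e.symm i)

theorem exists_free_of_lt_card {k : ℕ} (c : Fin k → V) {T : Finset V} (hT : k < T.card) :
    ∃ v ∈ T, ∀ i, c i ≠ v := by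
  classical
  by_contra! h
  have hsub : T ⊆ Finset.univ.image c := fun v hv => by simpa using h v hv
  have := (Finset.card_le_card hsub).trans Finset.card_image_le
  simp only [Finset.card_univ, Fintype.card_fin] at this
  omega

/-- The robber evades `k` cops forever inside a set `S` of vertices having more than `k`
neighbours each, provided he can always reach more than `k` vertices of `S` in one move. -/
theorem not_copsWinWith_of_refuge {k : ℕ} (S : Set V) (hne : S.Nonempty)
    (hstep : ∀ r ∈ S, ∃ T : Finset V, k < T.card ∧ ∀ v ∈ T, v ∈ S ∧ RobberMove G r v)
    (hdeg : ∀ r ∈ S, ∃ T : Finset V, k < T.card ∧ ∀ v ∈ T, G.Adj r v) :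
    ¬ CopsWinWith G k := by
  have evade : ∀ {j : ℕ} {c : Fin j → V} {r : V}, CopsWin G c r → j = k → r ∉ S := by
    intro j c r h
    induction h with
    | surround c r c' _ hsur =>
      rintro rfl hr
      obtain ⟨T, hT, hadj⟩ := hdeg r hr
      obtain ⟨v, hv, hfree⟩ := exists_free_of_lt_card c' hT
      obtain ⟨i, hi⟩ := hsur v (hadj v hv)
      exact hfree i hi
    | step c r c' _ _ ih =>
      rintro rfl hr
      obtain ⟨T, hT, hmem⟩ := hstep r hr
      obtain ⟨v, hv, hfree⟩ := exists_free_of_lt_card c' hT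
      exact ih v (hmem v hv).2 hfree rfl (hmem v hv).1
  rintro ⟨c, hc⟩
  obtain ⟨r, hr⟩ := hne
  obtain ⟨T, hT, hmem⟩ := hstep r hr
  obtain ⟨v, hv, hfree⟩ := exists_free_of_lt_card c hT
  exact evade (hc v hfree) rfl (hmem v hv).1

/-- Two cops starting at `z` win if they can surround every vertex not adjacent to `z` at once,
and if pushing the robber off a neighbour `r` of `z` lets them surround him next. -/
theorem copsWinWith_two_of_hub (z : V)
    (hfar : ∀ r, r ≠ z → ¬ G.Adj z r → ∃ u v, RobberMove G z u ∧ RobberMove G z v ∧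
      ∀ w, G.Adj r w → w = u ∨ w = v)
    (hnear : ∀ r, G.Adj z r → ∀ r', G.Adj r r' → r' ≠ z → ∃ u, RobberMove G z u ∧
      ∀ w, G.Adj r' w → w = r ∨ w = u) :
    CopsWinWith G 2 := by
  refine ⟨![z, z], fun r hr => ?_⟩
  by_cases hz : G.Adj z r
  · refine .step _ _ ![r, z] ?_ fun r' hr' hfree => ?_
    · simp [CopsMove, Fin.forall_fin_two, hz]
    · have hr'r : r ≠ r' := hfree 0
      obtain ⟨u, hu, hsur⟩ := hnear r hz r' (hr'.resolve_left hr'r.symm) (hfree 1).symm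
      refine .surround _ _ ![r, u] ?_ fun w hw => ?_
      · simpa [CopsMove, Fin.forall_fin_two, RobberMove] using hu
      · simpa [Fin.exists_fin_two, eq_comm] using hsur w hw
  · obtain ⟨u, v, hu, hv, hsur⟩ := hfar r (hr 0).symm hz
    refine .surround _ _ ![u, v] ?_ fun w hw => ?_
    · simpa [CopsMove, Fin.forall_fin_two, RobberMove] using ⟨hu, hv⟩
    · simpa [Fin.exists_fin_two, eq_comm] using hsur w hw

end General

section LowerBounds

theorem pathGraph_exists_adj {m : ℕ} (hm : 2 ≤ m) (i : Fin m) :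
    ∃ j, (pathGraph m).Adj i j := by
  simp only [pathGraph_adj]
  by_cases h : i.val + 1 < m
  · exact ⟨⟨i + 1, h⟩, Or.inl rfl⟩
  · exact ⟨⟨i - 1, by omega⟩, Or.inr (by simp only; omega)⟩

theorem not_copsWinWith_grid_of_lt_two {m n k : ℕ} (hm : 2 ≤ m) (hn : 2 ≤ n) (hk : k < 2) :
    ¬ CopsWinWith ((pathGraph m).boxProd (pathGraph n)) k := by
  have nbrs : ∀ r : Fin m × Fin n, ∃ T : Finset (Fin m × Fin n), k < T.card ∧
      ∀ v ∈ T, ((pathGraph m).boxProd (pathGraph n)).Adj r v := by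
    rintro ⟨i, j⟩
    obtain ⟨i', hi⟩ := pathGraph_exists_adj hm i
    obtain ⟨j', hj⟩ := pathGraph_exists_adj hn j
    refine ⟨{(i', j), (i, j')}, ?_, ?_⟩
    · rwa [Finset.card_pair (by simp [hi.ne'])]
    · simp [boxProd_adj, hi, hj]
  refine not_copsWinWith_of_refuge Set.univ ⟨(⟨0, by omega⟩, ⟨0, by omega⟩), trivial⟩
    (fun r _ => ?_) fun r _ => nbrs r
  obtain ⟨T, hT, h⟩ := nbrs r
  exact ⟨T, hT, fun v hv => ⟨trivial, Or.inr (h v hv)⟩⟩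

theorem not_copsWinWith_grid_of_lt_three {m n k : ℕ} (hm : 2 ≤ m) (hn : 4 ≤ n) (hk : k < 3) :
    ¬ CopsWinWith ((pathGraph m).boxProd (pathGraph n)) k := by
  refine not_copsWinWith_of_refuge {r | 1 ≤ r.2.val ∧ r.2.val + 2 ≤ n}
    ⟨(⟨0, by omega⟩, ⟨1, by omega⟩), by simp; omega⟩ ?_ ?_
  · rintro ⟨i, j⟩ ⟨hj₁, hj₂⟩
    simp only at hj₁ hj₂
    obtain ⟨i', hi⟩ := pathGraph_exists_adj hm i
    obtain ⟨j', hj, hj'⟩ : ∃ j' : Fin n, (pathGraph n).Adj j j' ∧ 1 ≤ j'.val ∧ j'.val + 2 ≤ n := by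
      simp only [pathGraph_adj]
      by_cases h : j.val + 3 ≤ n
      · exact ⟨⟨j + 1, by omega⟩, Or.inl rfl, by simp only; omega⟩
      · exact ⟨⟨j - 1, by omega⟩, by simp only; omega⟩
    refine ⟨{(i, j), (i', j), (i, j')}, ?_, ?_⟩
    · rwa [Finset.card_eq_three.2 ⟨_, _, _, ?_, ?_, ?_, rfl⟩] <;> simp [hi.ne, hi.ne', hj.ne]
    · simp [RobberMove, boxProd_adj, hi, hj, hj₁, hj₂, hj']
  · rintro ⟨i, j⟩ ⟨hj₁, hj₂⟩
    simp only at hj₁ hj₂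
    obtain ⟨i', hi⟩ := pathGraph_exists_adj hm i
    refine ⟨{(i', j), (i, ⟨j - 1, by omega⟩), (i, ⟨j + 1, by omega⟩)}, ?_, ?_⟩
    · rwa [Finset.card_eq_three.2 ⟨_, _, _, ?_, ?_, ?_, rfl⟩] <;>
        simp [hi.ne']
    · rw [pathGraph_adj] at hi
      simp [boxProd_adj, pathGraph_adj]
      omega

end LowerBounds

section SmallGrids

theorem copsWinWith_two_grid {m n : ℕ} (hm : 2 ≤ m) (hm' : m ≤ 3) (hn : 2 ≤ n) (hn' : n ≤ 3) :
    CopsWinWith ((pathGraph m).boxProd (pathGraph n)) 2 := by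
  refine copsWinWith_two_of_hub (⟨1, hm⟩, ⟨1, hn⟩) ?_ ?_ <;>
    simp only [RobberMove, boxProd_adj, pathGraph_adj, Prod.forall, Prod.mk.injEq, Fin.ext_iff,
      ne_eq]
  · exact fun i j hne hnadj => ⟨(⟨1, hm⟩, j), (i, ⟨1, hn⟩), by grind⟩
  · intro i j hadj i' j' hadj' hne
    by_cases hi : i.val = 1
    · exact ⟨(i', ⟨1, hn⟩), by grind⟩
    · exact ⟨(⟨1, hm⟩, j'), by grind⟩

end SmallGrids

section ThreeCops

/-- Two points of `ℕ × ℕ` are equal or neighbours in the infinite grid. -/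
def Near (p q : ℕ × ℕ) : Prop :=
  (q.1 = p.1 ∧ (q.2 = p.2 ∨ q.2 = p.2 + 1 ∨ p.2 = q.2 + 1)) ∨
    (q.2 = p.2 ∧ (q.1 = p.1 + 1 ∨ p.1 = q.1 + 1))

theorem Near.mk {a b c d : ℕ}
    (h : (c = a ∧ (d = b ∨ d = b + 1 ∨ b = d + 1)) ∨ (d = b ∧ (c = a + 1 ∨ a = c + 1))) :
    Near (a, b) (c, d) :=
  h

theorem Near.refl (p : ℕ × ℕ) : Near p p :=
  Or.inl ⟨rfl, Or.inl rfl⟩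

/-- The retraction of the infinite grid onto the `(M + 1) × (N + 1)` grid. -/
def clamp (M N : ℕ) (p : ℕ × ℕ) : Fin (M + 1) × Fin (N + 1) :=
  (⟨min p.1 M, by omega⟩, ⟨min p.2 N, by omega⟩)

/-- Three cops standing at the retractions of `A`, `B` and `C` win against a robber at `r`. -/
def ClampedWin (M N : ℕ) (A B C r : ℕ × ℕ) : Prop :=
  CopsWin ((pathGraph (M + 1)).boxProd (pathGraph (N + 1)))
    ![clamp M N A, clamp M N B, clamp M N C] (clamp M N r)

variable {M N : ℕ}

theorem clamp_near {p q : ℕ × ℕ} (h : Near p q) :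
    clamp M N q = clamp M N p ∨
      ((pathGraph (M + 1)).boxProd (pathGraph (N + 1))).Adj (clamp M N p) (clamp M N q) := by
  simp only [Near] at h
  simp only [clamp, boxProd_adj, pathGraph_adj, Prod.mk.injEq, Fin.mk.injEq]
  omega

theorem exists_near_of_robberMove {x y : ℕ} (hx : x ≤ M) (hy : y ≤ N)
    {r' : Fin (M + 1) × Fin (N + 1)}
    (h : RobberMove ((pathGraph (M + 1)).boxProd (pathGraph (N + 1))) (clamp M N (x, y)) r') :
    ∃ x' y', x' ≤ M ∧ y' ≤ N ∧ Near (x, y) (x', y') ∧ r' = clamp M N (x', y') := by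
  obtain ⟨⟨x', hx'⟩, ⟨y', hy'⟩⟩ := r'
  refine ⟨x', y', by omega, by omega, ?_, ?_⟩
  · simp only [RobberMove, clamp, boxProd_adj, pathGraph_adj, Prod.mk.injEq, Fin.mk.injEq] at h
    simp only [Near]
    omega
  · simp only [clamp, Prod.mk.injEq, Fin.mk.injEq]
    omega

/-- The cops may play as if the board were infinite while the robber is confined to the grid. -/
theorem ClampedWin.step {A B C : ℕ × ℕ} {x y : ℕ} (A' B' C' : ℕ × ℕ) (hx : x ≤ M) (hy : y ≤ N)
    (hA : Near A A') (hB : Near B B') (hC : Near C C')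
    (hnext : ∀ x' y', x' ≤ M → y' ≤ N → Near (x, y) (x', y') → (x', y') ≠ A' → (x', y') ≠ B' →
      (x', y') ≠ C' → ClampedWin M N A' B' C' (x', y')) :
    ClampedWin M N A B C (x, y) := by
  refine CopsWin.step _ _ ![clamp M N A', clamp M N B', clamp M N C'] ?_ fun r' hr' hfree => ?_
  · intro i
    fin_cases i
    exacts [clamp_near hA, clamp_near hB, clamp_near hC]
  · obtain ⟨x', y', hx', hy', hnear, rfl⟩ := exists_near_of_robberMove hx hy hr'
    refine hnext x' y' hx' hy' hnear ?_ ?_ ?_ <;> rintro rfl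
    exacts [hfree 0 rfl, hfree 1 rfl, hfree 2 rfl]

theorem ClampedWin.swap {A B C r : ℕ × ℕ} (h : ClampedWin M N C B A r) :
    ClampedWin M N A B C r := by
  have := CopsWin.comp_perm h (Equiv.swap 0 2)
  unfold ClampedWin
  convert this using 1
  ext i : 1
  fin_cases i <;> rfl

theorem exists_near_closer {p q a b : ℕ} (h : (p, q) ≠ (a, b)) :
    ∃ p' q', Near (p, q) (p', q') ∧ Nat.dist p' a + Nat.dist q' b < Nat.dist p a + Nat.dist q b := by
  simp only [Near, Nat.dist, ne_eq, Prod.mk.injEq] at h ⊢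
  rcases lt_trichotomy p a with hp | hp | hp
  · exact ⟨p + 1, q, by omega, by omega⟩
  · rcases lt_trichotomy q b with hq | hq | hq
    · exact ⟨p, q + 1, by omega, by omega⟩
    · omega
    · exact ⟨p, q - 1, by omega, by omega⟩
  · exact ⟨p - 1, q, by omega, by omega⟩

/-- With one cop in the robber's row to his right and another in his column above him, three cops
drive the robber into the corner `(0, 0)`.  Here the robber has just moved from `(x, y)` to
`(x', y')`. -/
theorem clampedWin_of_aligned {a b p q x y x' y' : ℕ} (hxa : x < a) (hyb : y < b)
    (hx' : x' ≤ M) (hy' : y' ≤ N) (hnear : Near (x, y) (x', y'))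
    (hA : (x', y') ≠ (a, y)) (hB : (x', y') ≠ (x, b)) :
    ClampedWin M N (a, y) (x, b) (p, q) (x', y') := by
  have hcases : (x' + 1 = x ∧ y' = y) ∨ (x' = x ∧ y' + 1 = y) ∨ (x' = x + 1 ∧ y' = y) ∨
      (x' = x ∧ y' = y + 1) ∨ (x' = x ∧ y' = y) := by
    simp only [Near] at hnear
    omega
  simp only [ne_eq, Prod.mk.injEq] at hA hB
  rcases hcases with ⟨rfl, rfl⟩ | ⟨rfl, rfl⟩ | ⟨rfl, rfl⟩ | ⟨rfl, rfl⟩ | ⟨rfl, rfl⟩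
  · refine .step (a - 1, y') (x', b) (p, q) hx' hy' (.mk (by omega))
      (.mk (by omega)) (.refl _) fun u v hu hv h hA hB _ => ?_
    exact clampedWin_of_aligned (by omega) (by omega) hu hv h hA hB
  · refine .step (a, y') (x', b - 1) (p, q) hx' hy' (.mk (by omega))
      (.mk (by omega)) (.refl _) fun u v hu hv h hA hB _ => ?_
    exact clampedWin_of_aligned (by omega) (by omega) hu hv h hA hB
  · refine .step (a, y') (x + 1, b) (p, q) hx' hy' (.refl _)
      (.mk (by omega)) (.refl _) fun u v hu hv h hA hB _ => ?_
    exact clampedWin_of_aligned (by omega) (by omega) hu hv h hA hB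
  · refine .step (a, y + 1) (x', b) (p, q) hx' hy' (.mk (by omega))
      (.refl _) (.refl _) fun u v hu hv h hA hB _ => ?_
    exact clampedWin_of_aligned (by omega) (by omega) hu hv h hA hB
  · by_cases ha : x' + 1 < a
    · refine .step (a - 1, y') (x', b) (p, q) hx' hy' (.mk (by omega))
        (.refl _) (.refl _) fun u v hu hv h hA hB _ => ?_
      exact clampedWin_of_aligned (by omega) (by omega) hu hv h hA hB
    by_cases hb : y' + 1 < b
    · refine .step (a, y') (x', b - 1) (p, q) hx' hy' (.refl _)
        (.mk (by omega)) (.refl _) fun u v hu hv h hA hB _ => ?_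
      exact clampedWin_of_aligned (by omega) (by omega) hu hv h hA hB
    by_cases hC : (p, q) = (a, y')
    · obtain ⟨rfl, rfl⟩ := Prod.mk.inj hC
      obtain rfl : p = x' + 1 := by omega
      obtain rfl : b = q + 1 := by omega
      -- One of the two cops on the right lands on the robber, who must then go left or down.
      refine .step (x', q) (x', q + 1) (x' + 1, q) hx' hy' (.mk (by omega))
        (.refl _) (.refl _) fun u v hu hv h hA hB hC => ?_
      have huv : (u + 1 = x' ∧ v = q) ∨ (u = x' ∧ v + 1 = q) := by
        simp only [Near, ne_eq, Prod.mk.injEq] at h hA hB hC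
        omega
      rcases huv with ⟨rfl, rfl⟩ | ⟨rfl, rfl⟩
      · refine .step (u + 1, v) (u, v + 1) (u + 2, v) hu hv (.refl _)
          (.mk (by omega)) (.refl _) fun s t hs ht h hA hB _ => ?_
        exact clampedWin_of_aligned (by omega) (by omega) hs ht h hA hB
      · refine .swap (.step (u + 1, v) (u, v + 1) (u, v + 1) hu hv (.mk (by omega))
          (.mk (by omega)) (.refl _) fun s t hs ht h hA hB _ => ?_)
        exact clampedWin_of_aligned (by omega) (by omega) hs ht h hA hB
    · obtain ⟨p', q', hp, hlt⟩ := exists_near_closer hC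
      refine .step (a, y') (x', b) (p', q') hx' hy' (.refl _) (.refl _) hp
        fun u v hu hv h hA hB _ => ?_
      exact clampedWin_of_aligned (by omega) (by omega) hu hv h hA hB
termination_by (a + b, (a - x) + (b - y), Nat.dist p a + Nat.dist q y)
decreasing_by
  all_goals
    first
    | exact Prod.Lex.left _ _ (by omega)
    | exact Prod.Lex.right _ (Prod.Lex.left _ _ (by omega))
    | subst_vars
      exact Prod.Lex.right _ (Prod.Lex.right _ hlt)

/-- A token at `s` on the path chases a point at or beyond it that has moved from `t` to `t'`. -/
theorem exists_chase {L s t t' : ℕ} (hst : s ≤ t) (ht : t ≤ L) (ht' : t' ≤ L)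
    (h : t' = t ∨ t' = t + 1 ∨ t = t' + 1) :
    ∃ s' ≤ t', (s' = s ∨ s' = s + 1 ∨ s = s' + 1) ∧
      (if s' = t' then 0 else L - s') ≤ (if s = t then 0 else L - s) ∧
      (s ≠ t → (if s' = t' then 0 else L - s') < (if s = t then 0 else L - s)) := by
  by_cases hs : s = t ∨ s = t' ∨ s + 1 = t'
  · refine ⟨t', le_rfl, by omega, by simp, fun _ => ?_⟩
    simp only [if_true]
    split_ifs <;> omega
  · refine ⟨s + 1, by omega, by omega, ?_, fun _ => ?_⟩ <;> split_ifs <;> omega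

/-- A cop beyond the right edge and a cop beyond the upper edge reach the robber's row and column
respectively. -/
theorem clampedWin_of_chase {s t x y x' y' : ℕ} (hs : s ≤ y) (ht : t ≤ x)
    (hx : x ≤ M) (hy : y ≤ N) (hx' : x' ≤ M) (hy' : y' ≤ N) (hnear : Near (x, y) (x', y')) :
    ClampedWin M N (M + 1, s) (t, N + 1) (0, 0) (x', y') := by
  by_cases hst : s = y ∧ t = x
  · obtain ⟨rfl, rfl⟩ := hst
    refine clampedWin_of_aligned (by omega) (by omega) hx' hy' hnear ?_ ?_ <;>
      simp only [ne_eq, Prod.mk.injEq] <;> omega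
  · have hxx : x' = x ∨ x' = x + 1 ∨ x = x' + 1 := by
      simp only [Near] at hnear
      omega
    have hyy : y' = y ∨ y' = y + 1 ∨ y = y' + 1 := by
      simp only [Near] at hnear
      omega
    obtain ⟨s', hs', hss, hsle, hslt⟩ := exists_chase hs hy hy' hyy
    obtain ⟨t', ht', htt, htle, htlt⟩ := exists_chase ht hx hx' hxx
    refine .step (M + 1, s') (t', N + 1) (0, 0) hx' hy' (.mk (by omega))
      (.mk (by omega)) (.refl _) fun u v hu hv h _ _ _ => ?_
    exact clampedWin_of_chase hs' ht' hx' hy' hu hv h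
termination_by (if s = y then 0 else N - s) + (if t = x then 0 else M - t)
decreasing_by omega

theorem copsWinWith_three_grid {m n : ℕ} (hm : 1 ≤ m) (hn : 1 ≤ n) :
    CopsWinWith ((pathGraph m).boxProd (pathGraph n)) 3 := by
  obtain ⟨M, rfl⟩ := Nat.exists_eq_add_of_le' hm
  obtain ⟨N, rfl⟩ := Nat.exists_eq_add_of_le' hn
  refine ⟨![clamp M N (M + 1, 0), clamp M N (0, N + 1), clamp M N (0, 0)], fun r _ => ?_⟩
  have hr : r = clamp M N (r.1, r.2) := by
    ext <;> simp only [clamp] <;> omega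
  rw [hr]
  exact clampedWin_of_chase (Nat.zero_le _) (Nat.zero_le _) (by omega) (by omega) (by omega)
    (by omega) (.refl (r.1.val, r.2.val))

end ThreeCops

end SurroundGame

/-- For `2 ≤ m ≤ n`, `σ(P_m □ P_n) = 2` if `m, n ≤ 3` and `3` otherwise. -/
theorem surroundNumber_grid (m n : ℕ) (hm : 2 ≤ m) (hmn : m ≤ n) :
    surroundNumber ((SimpleGraph.pathGraph m).boxProd (SimpleGraph.pathGraph n)) =
      if m ≤ 3 ∧ n ≤ 3 then 2 else 3 := by
  unfold surroundNumber
  split_ifs with h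
  · have hwin := copsWinWith_two_grid hm h.1 (hm.trans hmn) h.2
    refine le_antisymm (Nat.sInf_le hwin) (le_csInf ⟨2, hwin⟩ fun k hk => ?_)
    by_contra! hlt
    exact not_copsWinWith_grid_of_lt_two hm (hm.trans hmn) hlt hk
  · have hwin := copsWinWith_three_grid (m := m) (n := n) (by omega) (by omega)
    refine le_antisymm (Nat.sInf_le hwin) (le_csInf ⟨3, hwin⟩ fun k hk => ?_)
    by_contra! hlt
    exact not_copsWinWith_grid_of_lt_three hm (by omega) hlt hk
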